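/- Cylindric summation formula for skew Schur functions: for 2h alphabets X^0,...,X^{h-1} and Y^0,...,Y^{h-1}, with X = X^0+...+X^{h-1} and Y = Y^0+...+Y^{h-1} their unions, one has Σ_{λ^0,...,λ^h with λ^0=λ^h} Σ_{μ^0,...,μ^{h-1}} z^{|λ^h|} ∏_{i=0}^{h-1} s_{λ^i/μ^i}(X^i) s_{λ^{i+1}/μ^i}(Y^i) = ∏_{0≤i<j≤h-1} Ψ(Y^i, X^j) · ∏_{k≥1} Ψ(z^k X, Y)/(1−z^k), as an identity of formal power series, where the sums range over all integer partitions and z^k X denotes the alphabet X with every variable multiplied by z^k. -/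

import Mathlib

open scoped BigOperators

/-- An integer partition: a weakly decreasing, finitely supported sequence of
nonnegative integers. -/
structure Ptn where
  toFun : ℕ →₀ ℕ
  antitone' : ∀ ⦃i j : ℕ⦄, i ≤ j → toFun j ≤ toFun i

namespace Ptn
/-- the `i`-th part (0-indexed) -/
def part (lam : Ptn) (i : ℕ) : ℕ := lam.toFun i
/-- the size `|λ|` -/
def size (lam : Ptn) : ℕ := lam.toFun.sum fun _ k => k
end Ptn

/-- `HStrip μ λ` means `μ ≺ λ`, i.e. `λ/μ` is a horizontal strip:
`λ_i ≥ μ_i ≥ λ_{i+1}` for all `i`. -/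
def HStrip (mu lam : Ptn) : Prop :=
  ∀ i : ℕ, mu.part i ≤ lam.part i ∧ lam.part (i + 1) ≤ mu.part i
/-- Chains of partitions `μ = c 0 ≺ c 1 ≺ ⋯` stabilizing at `λ`; these encode
semistandard Young tableaux of shape `λ/μ` with entries in `{0, 1, 2, …}`. -/
def IsSchurChain (mu lam : Ptn) (c : ℕ → Ptn) : Prop :=
  c 0 = mu ∧ (∀ i, HStrip (c i) (c (i + 1))) ∧ ∃ N, ∀ i, N ≤ i → c i = lam

/-- the monomial attached to a chain: the variable `X i` records the cells added
at step `i` of the chain -/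
noncomputable def chainWeight {R : Type*} [CommRing R] (X : ℕ → R) (c : ℕ → Ptn) : R :=
  ∏ᶠ i : ℕ, X i ^ ((c (i + 1)).size - (c i).size)

/-- the skew Schur function `s_{λ/μ}(X)` (which is `0` if `μ ⊄ λ`) -/
noncomputable def skewSchur {R : Type*} [CommRing R] [TopologicalSpace R]
    (X : ℕ → R) (lam mu : Ptn) : R :=
  ∑' c : {c : ℕ → Ptn // IsSchurChain mu lam c}, chainWeight X c.1

/-- `Ψ(X,Y) = ∏_{i,j} (1 - x_i y_j)⁻¹` -/
noncomputable def Psi {R : Type*} [CommRing R] [TopologicalSpace R] [Inv R] (X Y : ℕ → R) : R :=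
  ∏' p : ℕ × ℕ, (1 - X p.1 * Y p.2)⁻¹

/-- `Φ(X) = ∏_i (1 - x_i)⁻¹ ∏_{i<j} (1 - x_i x_j)⁻¹` -/
noncomputable def Phi {R : Type*} [CommRing R] [TopologicalSpace R] [Inv R] (X : ℕ → R) : R :=
  (∏' i : ℕ, (1 - X i)⁻¹) * ∏' p : {q : ℕ × ℕ // q.1 < q.2}, (1 - X p.1.1 * X p.1.2)⁻¹
/-- the coefficientwise (product) topology on multivariate formal power series -/
instance (σ : Type*) : TopologicalSpace (MvPowerSeries σ ℚ) :=
  inferInstanceAs (TopologicalSpace ((σ →₀ ℕ) → ℚ))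

/-- the ambient ring: formal power series in the independent variables
`x^{(i)}_n`, `y^{(i)}_n` (`i, n ∈ ℕ`) and `z` -/
abbrev R2 : Type := MvPowerSeries ((Bool × ℕ × ℕ) ⊕ Unit) ℚ

/-- the alphabet `X^i = {x^{(i)}_0, x^{(i)}_1, …}` -/
noncomputable def Xa (i n : ℕ) : R2 := MvPowerSeries.X (Sum.inl (false, i, n))

/-- the alphabet `Y^i = {y^{(i)}_0, y^{(i)}_1, …}` -/
noncomputable def Ya (i n : ℕ) : R2 := MvPowerSeries.X (Sum.inl (true, i, n))

/-- the extra formal variable `z` -/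
noncomputable def z : R2 := MvPowerSeries.X (Sum.inr ())

/-- the union (disjoint sum) of the alphabets `A 0, …, A (h-1)` -/
noncomputable def unionA (h : ℕ) (A : ℕ → ℕ → R2) : ℕ → R2 :=
  fun n => if h = 0 then 0 else A (n % h) (n / h)

namespace Cylindric

open MvPowerSeries
open scoped ENNReal

variable {σ : Type*}

/-! ### Infinite sums of power series over `ℝ≥0∞` -/

/-- The coefficientwise sum of an arbitrary family of power series over `ℝ≥0∞`. -/
noncomputable def esum {I : Type*} (f : I → MvPowerSeries σ ℝ≥0∞) : MvPowerSeries σ ℝ≥0∞ :=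
  fun m => ∑' i, coeff m (f i)

section esum

variable {I J : Type*}

theorem coeff_esum (m : σ →₀ ℕ) (f : I → MvPowerSeries σ ℝ≥0∞) :
    coeff m (esum f) = ∑' i, coeff m (f i) := rfl

theorem mul_esum (a : MvPowerSeries σ ℝ≥0∞) (f : I → MvPowerSeries σ ℝ≥0∞) :
    a * esum f = esum fun i => a * f i := by
  classical
  ext m
  simp only [coeff_esum, coeff_mul]
  rw [Summable.tsum_finsetSum fun _ _ => ENNReal.summable]
  exact Finset.sum_congr rfl fun _ _ => ENNReal.tsum_mul_left.symm

theorem esum_mul (f : I → MvPowerSeries σ ℝ≥0∞) (a : MvPowerSeries σ ℝ≥0∞) :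
    esum f * a = esum fun i => f i * a := by
  simp only [mul_comm _ a, mul_esum]

theorem esum_comm (f : I → J → MvPowerSeries σ ℝ≥0∞) :
    (esum fun i => esum (f i)) = esum fun j => esum fun i => f i j := by
  ext m
  simp only [coeff_esum]
  exact ENNReal.tsum_comm

theorem esum_prod (f : I → J → MvPowerSeries σ ℝ≥0∞) :
    (esum fun p : I × J => f p.1 p.2) = esum fun i => esum (f i) := by
  ext m
  simp only [coeff_esum]
  exact ENNReal.tsum_prod (f := fun i j => coeff m (f i j))

theorem esum_equiv (e : I ≃ J) (f : J → MvPowerSeries σ ℝ≥0∞) :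
    (esum fun i => f (e i)) = esum f := by
  ext m
  simp only [coeff_esum]
  exact e.tsum_eq fun j => coeff m (f j)

theorem esum_injective {e : I → J} (he : e.Injective) {f : J → MvPowerSeries σ ℝ≥0∞}
    (hf : ∀ j, j ∉ Set.range e → f j = 0) : (esum fun i => f (e i)) = esum f := by
  ext m
  simp only [coeff_esum]
  refine he.tsum_eq (f := fun j => coeff m (f j)) fun j hj => ?_
  by_contra h
  exact hj (by simp [hf j h])

theorem esum_subtype {p : J → Prop} {f : J → MvPowerSeries σ ℝ≥0∞}
    (hf : ∀ j, ¬ p j → f j = 0) : (esum fun i : {j // p j} => f i) = esum f :=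
  esum_injective Subtype.val_injective fun j hj => hf j fun h => hj ⟨⟨j, h⟩, rfl⟩

theorem esum_eq_single (i : I) {f : I → MvPowerSeries σ ℝ≥0∞} (hf : ∀ j, j ≠ i → f j = 0) :
    esum f = f i := by
  ext m
  rw [coeff_esum]
  exact tsum_eq_single i fun j hj => by simp [hf j hj]

theorem esum_unique [Unique I] (f : I → MvPowerSeries σ ℝ≥0∞) : esum f = f default :=
  esum_eq_single _ fun _ hj => (hj (Subsingleton.elim _ _)).elim

theorem prod_esum : ∀ (h : ℕ) (f : Fin h → J → MvPowerSeries σ ℝ≥0∞),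
    ∏ i, esum (f i) = esum fun M : Fin h → J => ∏ i, f i (M i)
  | 0, f => by rw [esum_unique]; simp
  | h + 1, f => by
    rw [Fin.prod_univ_succ, prod_esum h, ← esum_equiv (Fin.consEquiv fun _ => J)]
    simp only [Fin.consEquiv_apply, Fin.prod_univ_succ, Fin.cons_zero, Fin.cons_succ]
    rw [esum_prod (fun a (M : Fin h → J) => f 0 a * ∏ i : Fin h, f i.succ (M i))]
    rw [esum_mul]
    simp only [mul_esum]

end esum

/-! ### Congruence of power series up to a given monomial -/

section Cong

variable {R : Type*}

/-- Two power series agree on all monomials dividing the monomial `m`. -/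
def Cong [Semiring R] (m : σ →₀ ℕ) (f g : MvPowerSeries σ R) : Prop :=
  ∀ k ≤ m, coeff k f = coeff k g

namespace Cong

section Semiring

variable [Semiring R] {m : σ →₀ ℕ} {f g f' g' k : MvPowerSeries σ R}

theorem refl (f : MvPowerSeries σ R) : Cong m f f := fun _ _ => rfl

theorem of_eq (h : f = g) : Cong m f g := h ▸ refl f

theorem trans (h : Cong m f g) (h' : Cong m g k) : Cong m f k :=
  fun k hk => (h k hk).trans (h' k hk)

theorem add (h : Cong m f g) (h' : Cong m f' g') : Cong m (f + f') (g + g') := fun k hk => by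
  rw [map_add, map_add, h k hk, h' k hk]

theorem mul (h : Cong m f g) (h' : Cong m f' g') : Cong m (f * f') (g * g') := fun k hk => by
  classical
  rw [coeff_mul, coeff_mul]
  refine Finset.sum_congr rfl fun p hp => ?_
  rw [Finset.HasAntidiagonal.mem_antidiagonal] at hp
  rw [h p.1 ((hp ▸ le_self_add).trans hk), h' p.2 ((hp ▸ le_add_self).trans hk)]

theorem mul_zero (h : Cong m f 0) (g : MvPowerSeries σ R) : Cong m (g * f) 0 := by
  simpa using (refl g).mul h

theorem zero_mul (h : Cong m f 0) (g : MvPowerSeries σ R) : Cong m (f * g) 0 := by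
  simpa using h.mul (refl g)

end Semiring

theorem prod [CommSemiring R] {m : σ →₀ ℕ} {I : Type*} {f g : I → MvPowerSeries σ R}
    (s : Finset I) (h : ∀ i ∈ s, Cong m (f i) (g i)) :
    Cong m (∏ i ∈ s, f i) (∏ i ∈ s, g i) := by
  classical
  induction s using Finset.induction_on with
  | empty => simpa using refl 1
  | insert a s ha ih =>
    rw [Finset.prod_insert ha, Finset.prod_insert ha]
    exact (h a (Finset.mem_insert_self _ _)).mul
      (ih fun i hi => h i (Finset.mem_insert_of_mem hi))

theorem prod_one [CommSemiring R] {m : σ →₀ ℕ} {I : Type*} {f : I → MvPowerSeries σ R}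
    (s : Finset I) (h : ∀ i ∈ s, Cong m (f i) 1) : Cong m (∏ i ∈ s, f i) 1 := by
  simpa using prod s h

theorem prod_subset [CommSemiring R] {m : σ →₀ ℕ} {I : Type*} {f : I → MvPowerSeries σ R}
    {s t : Finset I} (hst : s ⊆ t) (h : ∀ i ∈ t, i ∉ s → Cong m (f i) 1) :
    Cong m (∏ i ∈ t, f i) (∏ i ∈ s, f i) := by
  classical
  rw [← Finset.prod_sdiff hst]
  simpa using (prod_one (t \ s) fun i hi =>
    h i (Finset.mem_sdiff.1 hi).1 (Finset.mem_sdiff.1 hi).2).mul (refl (∏ i ∈ s, f i))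

theorem esum {m : σ →₀ ℕ} {I : Type*} {f g : I → MvPowerSeries σ ℝ≥0∞}
    (h : ∀ i, Cong m (f i) (g i)) : Cong m (esum f) (esum g) := fun k hk => by
  rw [coeff_esum, coeff_esum]
  exact tsum_congr fun i => h i k hk

end Cong

theorem pow_cong_zero [CommSemiring R] (m : σ →₀ ℕ) {f : MvPowerSeries σ R}
    (hf : constantCoeff f = 0) {n : ℕ} (hn : m.degree < n) : Cong m (f ^ n) 0 := fun k hk => by
  rw [map_zero]
  refine coeff_eq_zero_of_constantCoeff_nilpotent (m := 1) (by simpa using hf) ?_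
  have := Finsupp.degree_mono hk
  lia

theorem X_pow_cong_zero [CommSemiring R] (m : σ →₀ ℕ) (s : σ) {n : ℕ} (hn : m s < n) :
    Cong m ((X s : MvPowerSeries σ R) ^ n) 0 := fun k hk => by
  classical
  rw [map_zero, coeff_X_pow, if_neg]
  rintro rfl
  have := hk s
  simp at this
  lia

end Cong

/-- The geometric series `1 + x + x² + ⋯`. -/
noncomputable def geo (x : MvPowerSeries σ ℝ≥0∞) : MvPowerSeries σ ℝ≥0∞ := esum fun n : ℕ => x ^ n

theorem geo_cong_sum (m : σ →₀ ℕ) {x : MvPowerSeries σ ℝ≥0∞} {d : ℕ}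
    (hx : ∀ n, d ≤ n → Cong m (x ^ n) 0) : Cong m (geo x) (∑ n ∈ Finset.range d, x ^ n) := by
  intro k hk
  rw [geo, coeff_esum, map_sum]
  exact tsum_eq_sum fun n hn => by
    simpa using hx n (by simpa using hn) k hk

/-! ### Partitions and horizontal strips -/

section Partitions

theorem ptn_ext {lam mu : Ptn} (h : ∀ i, lam.part i = mu.part i) : lam = mu := by
  obtain ⟨f, hf⟩ := lam
  obtain ⟨g, hg⟩ := mu
  obtain rfl : f = g := Finsupp.ext h
  rfl

theorem part_antitone (lam : Ptn) : Antitone lam.part := fun _ _ h => lam.antitone' h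

theorem exists_part_eq_zero (lam : Ptn) : ∃ M, lam.part M = 0 := by
  obtain ⟨M, hM⟩ := lam.toFun.support.exists_notMem
  exact ⟨M, by simpa [Ptn.part] using hM⟩

theorem part_eq_zero_of_le {lam : Ptn} {M i : ℕ} (hM : lam.part M = 0) (h : M ≤ i) :
    lam.part i = 0 :=
  Nat.le_zero.1 (hM ▸ part_antitone lam h)

theorem size_eq_sum {lam : Ptn} {M : ℕ} (hM : lam.part M = 0) :
    lam.size = ∑ i ∈ Finset.range M, lam.part i := by
  refine Finsupp.sum_of_support_subset _ (fun i hi => ?_) _ fun _ _ => rfl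
  rw [Finset.mem_range]
  by_contra h
  exact Finsupp.mem_support_iff.1 hi (part_eq_zero_of_le hM (not_lt.1 h))

/-- The partition with prescribed parts. -/
noncomputable def ptnOf (f : ℕ → ℕ) (hf : Antitone f) (h0 : ∃ M, f M = 0) : Ptn where
  toFun := Finsupp.onFinset (Finset.range h0.choose) f fun i hi => by
    rw [Finset.mem_range]
    by_contra h
    exact hi (Nat.le_zero.1 (h0.choose_spec ▸ hf (not_lt.1 h)))
  antitone' := fun _ _ h => hf h

@[simp]
theorem part_ptnOf (f : ℕ → ℕ) (hf : Antitone f) (h0 : ∃ M, f M = 0) (i : ℕ) :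
    (ptnOf f hf h0).part i = f i := rfl

theorem exists_common_zero (lam mu : Ptn) : ∃ M, lam.part M = 0 ∧ mu.part M = 0 := by
  obtain ⟨M, hM⟩ := exists_part_eq_zero lam
  obtain ⟨N, hN⟩ := exists_part_eq_zero mu
  exact ⟨max M N, part_eq_zero_of_le hM (le_max_left _ _),
    part_eq_zero_of_le hN (le_max_right _ _)⟩

theorem hStrip_refl (lam : Ptn) : HStrip lam lam :=
  fun i => ⟨le_rfl, part_antitone lam i.le_succ⟩

theorem hStrip_size_le {mu lam : Ptn} (h : HStrip mu lam) : mu.size ≤ lam.size := by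
  obtain ⟨M, h1, h2⟩ := exists_common_zero mu lam
  rw [size_eq_sum h1, size_eq_sum h2]
  exact Finset.sum_le_sum fun i _ => (h i).1

theorem eq_of_hStrip_of_size_le {mu lam : Ptn} (h : HStrip mu lam) (hs : lam.size ≤ mu.size) :
    mu = lam := by
  obtain ⟨M, h1, h2⟩ := exists_common_zero mu lam
  have hs' := le_antisymm (hStrip_size_le h) hs
  rw [size_eq_sum h1, size_eq_sum h2,
    Finset.sum_eq_sum_iff_of_le fun i _ => (h i).1] at hs'
  refine ptn_ext fun i => ?_
  by_cases hi : i < M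
  · exact hs' i (Finset.mem_range.2 hi)
  · rw [part_eq_zero_of_le h1 (not_lt.1 hi), part_eq_zero_of_le h2 (not_lt.1 hi)]

theorem finite_hStrip (lam : Ptn) : {mu | HStrip mu lam}.Finite := by
  refine ((Set.finite_Iic lam.toFun).preimage (f := Ptn.toFun) ?_).subset fun mu h i => (h i).1
  rintro ⟨f, _⟩ _ ⟨g, _⟩ _ rfl
  rfl

theorem le_size_of_part_ne_zero {lam : Ptn} {n : ℕ} (h : lam.part n ≠ 0) : n < lam.size := by
  obtain ⟨M, hM⟩ := exists_part_eq_zero lam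
  have hnM : n < M := by
    by_contra hn
    exact h (part_eq_zero_of_le hM (not_lt.1 hn))
  rw [size_eq_sum hM]
  calc n < ∑ i ∈ Finset.range (n + 1), 1 := by simp
    _ ≤ ∑ i ∈ Finset.range (n + 1), lam.part i := Finset.sum_le_sum fun i hi =>
        (Nat.one_le_iff_ne_zero.2 h).trans
          (part_antitone lam (Nat.lt_succ_iff.1 (Finset.mem_range.1 hi)))
    _ ≤ _ := Finset.sum_le_sum_of_subset (Finset.range_subset_range.2 hnM)

/-- The parts of the partition `λ` built from `μ ≻ τ ≺ ν` and `k` by the local growth rule. -/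
def growthSeq (mu nu tau : Ptn) (k : ℕ) : ℕ → ℕ
  | 0 => max (mu.part 0) (nu.part 0) + k
  | i + 1 => min (mu.part i) (nu.part i) + max (mu.part (i + 1)) (nu.part (i + 1)) - tau.part i

theorem growthSeq_bounds {mu nu tau : Ptn} (k : ℕ) (h : HStrip tau mu ∧ HStrip tau nu) (i : ℕ) :
    growthSeq mu nu tau k (i + 1) ≤ min (mu.part i) (nu.part i) ∧
      max (mu.part i) (nu.part i) ≤ growthSeq mu nu tau k i := by
  have := h.1 i; have := h.2 i
  cases i with
  | zero => simp only [growthSeq]; omega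
  | succ i =>
    have := h.1 i; have := h.2 i
    simp only [growthSeq]
    omega

/-- The local growth rule: partitions `λ` with `μ ≺ λ ≻ ν` correspond to pairs of a natural
number and a partition `τ` with `μ ≻ τ ≺ ν`. -/
noncomputable def growthEquiv (mu nu : Ptn) :
    {lam // HStrip mu lam ∧ HStrip nu lam} ≃ ℕ × {tau // HStrip tau mu ∧ HStrip tau nu} where
  toFun l := (l.1.part 0 - max (mu.part 0) (nu.part 0),
    ⟨ptnOf (fun i => min (mu.part i) (nu.part i) + max (mu.part (i + 1)) (nu.part (i + 1))
        - l.1.part (i + 1))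
      (antitone_nat_of_succ_le fun i => by
        have := l.2.1 i; have := l.2.2 i
        have := l.2.1 (i + 1); have := l.2.2 (i + 1); have := l.2.1 (i + 1 + 1)
        have := l.2.2 (i + 1 + 1)
        omega)
      (by
        obtain ⟨M, h1, h2⟩ := exists_common_zero mu nu
        refine ⟨M, ?_⟩
        have := part_eq_zero_of_le h1 M.le_succ
        have := part_eq_zero_of_le h2 M.le_succ
        simp_all),
      fun i => by
        have := l.2.1 i; have := l.2.2 i
        have := l.2.1 (i + 1); have := l.2.2 (i + 1)
        rw [part_ptnOf]
        omega,
      fun i => by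
        have := l.2.1 i; have := l.2.2 i
        have := l.2.1 (i + 1); have := l.2.2 (i + 1)
        rw [part_ptnOf]
        omega⟩)
  invFun p :=
    ⟨ptnOf (growthSeq mu nu p.2.1 p.1)
      (antitone_nat_of_succ_le fun i => by
        have := growthSeq_bounds p.1 p.2.2 i
        omega)
      (by
        obtain ⟨M, h1, h2⟩ := exists_common_zero mu nu
        refine ⟨M + 1, ?_⟩
        have := growthSeq_bounds p.1 p.2.2 M
        omega),
      fun i => by
        have := growthSeq_bounds p.1 p.2.2 i
        rw [part_ptnOf, part_ptnOf]
        omega,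
      fun i => by
        have := growthSeq_bounds p.1 p.2.2 i
        rw [part_ptnOf, part_ptnOf]
        omega⟩
  left_inv l := by
    refine Subtype.ext (ptn_ext fun i => ?_)
    cases i with
    | zero =>
      have := l.2.1 0; have := l.2.2 0
      simp only [part_ptnOf, growthSeq]
      omega
    | succ i =>
      have := l.2.1 i; have := l.2.2 i
      have := l.2.1 (i + 1); have := l.2.2 (i + 1)
      simp only [part_ptnOf, growthSeq]
      omega
  right_inv p := by
    refine Prod.ext ?_ (Subtype.ext (ptn_ext fun i => ?_))
    · simp only [part_ptnOf, growthSeq]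
      omega
    · have := p.2.2.1 i; have := p.2.2.2 i
      have := p.2.2.1 (i + 1); have := p.2.2.2 (i + 1)
      simp only [part_ptnOf, growthSeq]
      omega

theorem size_growthEquiv (mu nu : Ptn) (l : {lam // HStrip mu lam ∧ HStrip nu lam}) :
    l.1.size + (growthEquiv mu nu l).2.1.size
      = mu.size + nu.size + (growthEquiv mu nu l).1 := by
  obtain ⟨M, h1, h2⟩ := exists_common_zero mu nu
  have hl : l.1.part (M + 1) = 0 := by have := l.2.1 M; omega
  have ht : (growthEquiv mu nu l).2.1.part M = 0 := by
    have := (growthEquiv mu nu l).2.2.1 M; omega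
  rw [size_eq_sum h1, size_eq_sum h2, size_eq_sum hl, size_eq_sum ht]
  have key : ∀ n, ∑ i ∈ Finset.range (n + 1), l.1.part i
      + ∑ i ∈ Finset.range n, (growthEquiv mu nu l).2.1.part i
      = ∑ i ∈ Finset.range n, mu.part i + ∑ i ∈ Finset.range n, nu.part i
        + (growthEquiv mu nu l).1 + max (mu.part n) (nu.part n) := fun n => by
    induction n with
    | zero =>
      have := l.2.1 0; have := l.2.2 0
      have h3 : (growthEquiv mu nu l).1 = l.1.part 0 - max (mu.part 0) (nu.part 0) := rfl
      simp only [zero_add, Finset.sum_range_one, Finset.sum_range_zero]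
      omega
    | succ n ih =>
      have := l.2.1 n; have := l.2.2 n
      have := l.2.1 (n + 1); have := l.2.2 (n + 1)
      have h3 : (growthEquiv mu nu l).2.1.part n = min (mu.part n) (nu.part n)
        + max (mu.part (n + 1)) (nu.part (n + 1)) - l.1.part (n + 1) := rfl
      simp only [Finset.sum_range_succ] at ih ⊢
      omega
  have := key M
  rw [h1, h2] at this
  simpa using this

/-- A partition with at most `K + 1` parts is a partition with at most `K` parts, together with
the number of columns of length `K + 1`. -/
noncomputable def columnEquiv (K : ℕ) :
    {lam : Ptn // lam.part (K + 1) = 0} ≃ ℕ × {lam : Ptn // lam.part K = 0} where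
  toFun l := (l.1.part K, ⟨ptnOf (fun i => l.1.part i - l.1.part K)
    (fun i j h => Nat.sub_le_sub_right (part_antitone l.1 h) _) ⟨K, Nat.sub_self _⟩,
    Nat.sub_self _⟩)
  invFun p := ⟨ptnOf (fun i => if i ≤ K then p.2.1.part i + p.1 else 0)
    (antitone_nat_of_succ_le fun i => by
      have := part_antitone p.2.1 i.le_succ
      grind) ⟨K + 1, by simp⟩, by simp⟩
  left_inv l := by
    refine Subtype.ext (ptn_ext fun i => ?_)
    rw [part_ptnOf]
    split_ifs with h
    · exact Nat.sub_add_cancel (part_antitone l.1 h)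
    · exact (part_eq_zero_of_le l.2 (not_le.1 h)).symm
  right_inv p := by
    have h0 := p.2.2
    refine Prod.ext (by simpa using h0) (Subtype.ext (ptn_ext fun i => ?_))
    simp only [part_ptnOf, le_refl, if_true, h0]
    split_ifs with h
    · omega
    · rw [part_eq_zero_of_le h0 (not_le.1 h).le]
      omega

theorem size_columnEquiv (K : ℕ) (l : {lam : Ptn // lam.part (K + 1) = 0}) :
    l.1.size = (columnEquiv K l).1 * (K + 1) + (columnEquiv K l).2.1.size := by
  rw [size_eq_sum l.2, size_eq_sum (columnEquiv K l).2.2, Finset.sum_range_succ]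
  have h : ∑ i ∈ Finset.range K, l.1.part i
      = ∑ i ∈ Finset.range K, ((columnEquiv K l).2.1.part i + l.1.part K) :=
    Finset.sum_congr rfl fun i hi =>
      (Nat.sub_add_cancel (part_antitone l.1 (Finset.mem_range.1 hi).le)).symm
  rw [h, Finset.sum_add_distrib, Finset.sum_const, Finset.card_range, smul_eq_mul]
  have : (columnEquiv K l).1 = l.1.part K := rfl
  rw [this]
  ring

end Partitions

/-! ### Kernels indexed by partitions -/

/-- Infinite matrices with rows and columns indexed by partitions. -/
def Kernel (σ : Type*) : Type _ := Ptn → Ptn → MvPowerSeries σ ℝ≥0∞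

namespace Kernel

@[ext]
theorem ext {A B : Kernel σ} (h : ∀ a b, A a b = B a b) : A = B := funext₂ h

open Classical in
noncomputable instance : One (Kernel σ) := ⟨fun a b => if a = b then 1 else 0⟩

noncomputable instance : Mul (Kernel σ) := ⟨fun A B a b => esum fun c => A a c * B c b⟩

noncomputable instance : SMul (MvPowerSeries σ ℝ≥0∞) (Kernel σ) := ⟨fun r A a b => r * A a b⟩

open Classical in
theorem one_apply (a b : Ptn) : (1 : Kernel σ) a b = if a = b then 1 else 0 := rfl

theorem mul_apply (A B : Kernel σ) (a b : Ptn) : (A * B) a b = esum fun c => A a c * B c b := rfl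

theorem one_apply_comm (a b : Ptn) : (1 : Kernel σ) a b = (1 : Kernel σ) b a := by
  by_cases h : a = b
  · rw [h]
  · rw [one_apply, one_apply, if_neg h, if_neg (Ne.symm h)]

theorem smul_apply (r : MvPowerSeries σ ℝ≥0∞) (A : Kernel σ) (a b : Ptn) :
    (r • A) a b = r * A a b := rfl

noncomputable instance : Monoid (Kernel σ) where
  mul_assoc A B C := by
    ext1 a b
    simp only [mul_apply, esum_mul, mul_esum]
    rw [esum_comm]
    simp only [mul_assoc]
  one_mul A := by
    ext1 a b
    rw [mul_apply, esum_eq_single a fun c hc => by rw [one_apply, if_neg hc.symm, zero_mul],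
      one_apply, if_pos rfl, one_mul]
  mul_one A := by
    ext1 a b
    rw [mul_apply, esum_eq_single b fun c hc => by rw [one_apply, if_neg hc, mul_zero],
      one_apply, if_pos rfl, mul_one]

noncomputable instance : MulAction (MvPowerSeries σ ℝ≥0∞) (Kernel σ) where
  one_smul A := by ext1 a b; rw [smul_apply, one_mul]
  mul_smul r s A := by ext1 a b; simp only [smul_apply, mul_assoc]

theorem smul_mul (r : MvPowerSeries σ ℝ≥0∞) (A B : Kernel σ) : (r • A) * B = r • (A * B) := by
  ext1 a b
  simp only [smul_apply, mul_apply, mul_esum, mul_assoc]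

theorem mul_smul_comm (r : MvPowerSeries σ ℝ≥0∞) (A B : Kernel σ) :
    A * (r • B) = r • (A * B) := by
  ext1 a b
  simp only [smul_apply, mul_apply, mul_esum, mul_left_comm]

/-- The trace of a kernel. -/
noncomputable def trace (A : Kernel σ) : MvPowerSeries σ ℝ≥0∞ := esum fun a => A a a

theorem trace_mul_comm (A B : Kernel σ) : trace (A * B) = trace (B * A) := by
  simp only [trace, mul_apply]
  rw [esum_comm]
  simp only [mul_comm]

theorem trace_smul (r : MvPowerSeries σ ℝ≥0∞) (A : Kernel σ) : trace (r • A) = r * trace A := by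
  simp only [trace, smul_apply, mul_esum]

/-- Entrywise congruence of kernels. -/
def KCong (m : σ →₀ ℕ) (A B : Kernel σ) : Prop := ∀ a b, Cong m (A a b) (B a b)

theorem KCong.refl {m : σ →₀ ℕ} (A : Kernel σ) : KCong m A A := fun _ _ => Cong.refl _

theorem KCong.mul {m : σ →₀ ℕ} {A B A' B' : Kernel σ} (h : KCong m A B) (h' : KCong m A' B') :
    KCong m (A * A') (B * B') :=
  fun a b => Cong.esum fun c => (h a c).mul (h' c b)

theorem KCong.trace {m : σ →₀ ℕ} {A B : Kernel σ} (h : KCong m A B) :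
    Cong m (trace A) (trace B) :=
  Cong.esum fun a => h a a

open Classical in
/-- The kernel adding a horizontal strip, with weight `x` per cell. -/
noncomputable def up (x : MvPowerSeries σ ℝ≥0∞) : Kernel σ :=
  fun a b => if HStrip a b then x ^ (b.size - a.size) else 0

/-- The kernel removing a horizontal strip, with weight `x` per cell. -/
noncomputable def down (x : MvPowerSeries σ ℝ≥0∞) : Kernel σ := fun a b => up x b a

open Classical in
/-- The diagonal kernel with entries `t ^ |λ|`. -/
noncomputable def sizeDiag (t : MvPowerSeries σ ℝ≥0∞) : Kernel σ :=
  fun a b => if a = b then t ^ a.size else 0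

theorem sizeDiag_mul_apply (t : MvPowerSeries σ ℝ≥0∞) (A : Kernel σ) (a b : Ptn) :
    (sizeDiag t * A) a b = t ^ a.size * A a b := by
  rw [mul_apply, esum_eq_single a fun c hc => by rw [sizeDiag, if_neg hc.symm, zero_mul],
    sizeDiag, if_pos rfl]

theorem mul_sizeDiag_apply (t : MvPowerSeries σ ℝ≥0∞) (A : Kernel σ) (a b : Ptn) :
    (A * sizeDiag t) a b = A a b * t ^ b.size := by
  rw [mul_apply, esum_eq_single b fun c hc => by rw [sizeDiag, if_neg hc, mul_zero],
    sizeDiag, if_pos rfl]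

theorem up_mul_pow (t x : MvPowerSeries σ ℝ≥0∞) (a b : Ptn) :
    up x a b * t ^ b.size = t ^ a.size * up (t * x) a b := by
  rw [up, up]
  split_ifs with h
  · obtain ⟨d, hd⟩ := Nat.exists_eq_add_of_le (hStrip_size_le h)
    rw [hd, Nat.add_sub_cancel_left, pow_add, mul_pow]
    ring
  · rw [zero_mul, mul_zero]

theorem up_mul_sizeDiag (t x : MvPowerSeries σ ℝ≥0∞) :
    up x * sizeDiag t = sizeDiag t * up (t * x) := by
  ext1 a b
  rw [mul_sizeDiag_apply, sizeDiag_mul_apply, up_mul_pow]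

theorem sizeDiag_mul_down (t x : MvPowerSeries σ ℝ≥0∞) :
    sizeDiag t * down x = down (t * x) * sizeDiag t := by
  ext1 a b
  rw [mul_sizeDiag_apply, sizeDiag_mul_apply, down, down, mul_comm, up_mul_pow, mul_comm]

theorem up_cong_one {m : σ →₀ ℕ} {x : MvPowerSeries σ ℝ≥0∞} (hx : Cong m x 0) :
    KCong m (up x) 1 := fun a b => by
  rw [up, one_apply]
  by_cases hab : a = b
  · subst hab
    rw [if_pos (hStrip_refl a), if_pos rfl, Nat.sub_self, pow_zero]
    exact Cong.refl _
  · rw [if_neg hab]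
    split_ifs with h
    · obtain ⟨d, hd⟩ : ∃ d, b.size - a.size = d + 1 := Nat.exists_eq_succ_of_ne_zero fun h0 =>
        hab (eq_of_hStrip_of_size_le h (Nat.sub_eq_zero_iff_le.1 h0))
      rw [hd, pow_succ]
      exact hx.mul_zero _
    · exact Cong.refl _

theorem down_cong_one {m : σ →₀ ℕ} {x : MvPowerSeries σ ℝ≥0∞} (hx : Cong m x 0) :
    KCong m (down x) 1 := fun a b => by
  rw [one_apply_comm]
  exact up_cong_one hx b a

/-- The skew Cauchy identity for two one-letter alphabets. -/
theorem up_mul_down (x y : MvPowerSeries σ ℝ≥0∞) :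
    up x * down y = geo (x * y) • (down y * up x) := by
  ext1 mu nu
  rw [smul_apply, mul_apply, mul_apply, geo, esum_mul]
  simp only [mul_esum]
  rw [← esum_subtype (p := fun lam => HStrip mu lam ∧ HStrip nu lam) fun lam h => by
    rw [down, up, up]
    grind]
  have h2 : ∀ k : ℕ, (esum fun tau => (x * y) ^ k * (down y mu tau * up x tau nu))
      = esum fun t : {tau // HStrip tau mu ∧ HStrip tau nu} =>
        (x * y) ^ k * (down y mu t.1 * up x t.1 nu) := fun k => by
    rw [← esum_subtype (p := fun tau => HStrip tau mu ∧ HStrip tau nu) fun tau h => by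
      rw [down, up, up]
      grind]
  simp only [h2]
  rw [← esum_prod fun (k : ℕ) (t : {tau // HStrip tau mu ∧ HStrip tau nu}) =>
    (x * y) ^ k * (down y mu t.1 * up x t.1 nu), ← esum_equiv (growthEquiv mu nu)]
  congr 1
  funext l
  have hs := size_growthEquiv mu nu l
  have h1 := hStrip_size_le l.2.1
  have h2 := hStrip_size_le l.2.2
  have h3 := hStrip_size_le (growthEquiv mu nu l).2.2.1
  have h4 := hStrip_size_le (growthEquiv mu nu l).2.2.2
  rw [down, down, up, up, up, up, if_pos l.2.1, if_pos l.2.2,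
    if_pos (growthEquiv mu nu l).2.2.1, if_pos (growthEquiv mu nu l).2.2.2,
    show l.1.size - mu.size = (growthEquiv mu nu l).1
      + (nu.size - (growthEquiv mu nu l).2.1.size) by omega,
    show l.1.size - nu.size = (growthEquiv mu nu l).1
      + (mu.size - (growthEquiv mu nu l).2.1.size) by omega, pow_add, pow_add, mul_pow]
  ring

/-- The product of the kernels `up x` for the letters `x` of a word. -/
noncomputable def upWord (l : List (MvPowerSeries σ ℝ≥0∞)) : Kernel σ := (l.map up).prod

/-- The product of the kernels `down x` for the letters `x` of a word. -/
noncomputable def downWord (l : List (MvPowerSeries σ ℝ≥0∞)) : Kernel σ := (l.map down).prod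

theorem upWord_cons (x : MvPowerSeries σ ℝ≥0∞) (l : List (MvPowerSeries σ ℝ≥0∞)) :
    upWord (x :: l) = up x * upWord l := by simp [upWord]

theorem downWord_cons (x : MvPowerSeries σ ℝ≥0∞) (l : List (MvPowerSeries σ ℝ≥0∞)) :
    downWord (x :: l) = down x * downWord l := by simp [downWord]

theorem upWord_append (l l' : List (MvPowerSeries σ ℝ≥0∞)) :
    upWord (l ++ l') = upWord l * upWord l' := by simp [upWord]

theorem downWord_append (l l' : List (MvPowerSeries σ ℝ≥0∞)) :
    downWord (l ++ l') = downWord l * downWord l' := by simp [downWord]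

theorem downWord_reverse_apply (l : List (MvPowerSeries σ ℝ≥0∞)) (a b : Ptn) :
    downWord l.reverse a b = upWord l b a := by
  induction l generalizing a b with
  | nil =>
    simp only [List.reverse_nil, upWord, downWord, List.map_nil, List.prod_nil]
    exact one_apply_comm a b
  | cons x l ih =>
    rw [List.reverse_cons, downWord_append, upWord_cons, mul_apply, mul_apply]
    congr 1
    funext c
    rw [ih, mul_comm]
    simp [downWord, down]

theorem upWord_mul_sizeDiag (t : MvPowerSeries σ ℝ≥0∞) (l : List (MvPowerSeries σ ℝ≥0∞)) :
    upWord l * sizeDiag t = sizeDiag t * upWord (l.map (t * ·)) := by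
  induction l with
  | nil => simp [upWord]
  | cons x l ih =>
    rw [List.map_cons, upWord_cons, upWord_cons, mul_assoc, ih, ← mul_assoc, up_mul_sizeDiag,
      mul_assoc]

theorem sizeDiag_mul_downWord (t : MvPowerSeries σ ℝ≥0∞) (l : List (MvPowerSeries σ ℝ≥0∞)) :
    sizeDiag t * downWord l = downWord (l.map (t * ·)) * sizeDiag t := by
  induction l with
  | nil => simp [downWord]
  | cons x l ih =>
    rw [List.map_cons, downWord_cons, downWord_cons, ← mul_assoc, sizeDiag_mul_down, mul_assoc,
      ih, ← mul_assoc]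

theorem upWord_cong_one {m : σ →₀ ℕ} {l : List (MvPowerSeries σ ℝ≥0∞)}
    (hl : ∀ x ∈ l, Cong m x 0) : KCong m (upWord l) 1 := by
  induction l with
  | nil => exact KCong.refl _
  | cons x l ih =>
    rw [upWord_cons, ← mul_one (1 : Kernel σ)]
    exact (up_cong_one (hl x (by simp))).mul (ih fun y hy => hl y (by simp [hy]))

theorem downWord_cong_one {m : σ →₀ ℕ} {l : List (MvPowerSeries σ ℝ≥0∞)}
    (hl : ∀ x ∈ l, Cong m x 0) : KCong m (downWord l) 1 := by
  induction l with
  | nil => exact KCong.refl _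
  | cons x l ih =>
    rw [downWord_cons, ← mul_one (1 : Kernel σ)]
    exact (down_cong_one (hl x (by simp))).mul (ih fun y hy => hl y (by simp [hy]))

/-- The Cauchy product `∏ (1 - x y)⁻¹` over the letters `x`, `y` of two words. -/
noncomputable def cauchy (l l' : List (MvPowerSeries σ ℝ≥0∞)) : MvPowerSeries σ ℝ≥0∞ :=
  (l.map fun x => (l'.map fun y => geo (x * y)).prod).prod

theorem cauchy_append_left (l₁ l₂ l' : List (MvPowerSeries σ ℝ≥0∞)) :
    cauchy (l₁ ++ l₂) l' = cauchy l₁ l' * cauchy l₂ l' := by simp [cauchy]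

theorem up_mul_downWord (x : MvPowerSeries σ ℝ≥0∞) (l' : List (MvPowerSeries σ ℝ≥0∞)) :
    up x * downWord l' = (l'.map fun y => geo (x * y)).prod • (downWord l' * up x) := by
  induction l' with
  | nil => simp [downWord]
  | cons y l' ih =>
    rw [downWord_cons, ← mul_assoc, up_mul_down, smul_mul, mul_assoc, ih, mul_smul_comm,
      smul_smul, List.map_cons, List.prod_cons, mul_assoc]

/-- The skew Cauchy identity. -/
theorem upWord_mul_downWord (l l' : List (MvPowerSeries σ ℝ≥0∞)) :
    upWord l * downWord l' = cauchy l l' • (downWord l' * upWord l) := by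
  induction l with
  | nil => simp [upWord, cauchy]
  | cons x l ih =>
    rw [upWord_cons, mul_assoc, ih, mul_smul_comm, ← mul_assoc, up_mul_downWord, smul_mul,
      smul_smul, mul_assoc, mul_comm, cauchy, cauchy, List.map_cons, List.prod_cons]

theorem trace_sizeDiag_mul_downWord_mul_upWord (t : MvPowerSeries σ ℝ≥0∞)
    (l l' : List (MvPowerSeries σ ℝ≥0∞)) :
    trace (sizeDiag t * (downWord l * upWord l')) = cauchy l' (l.map (t * ·)) *
      trace (sizeDiag t * (downWord (l.map (t * ·)) * upWord l')) := by
  rw [← mul_assoc, sizeDiag_mul_downWord, mul_assoc, trace_mul_comm, mul_assoc,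
    upWord_mul_downWord, mul_smul_comm, trace_smul]

theorem trace_iterate (t : MvPowerSeries σ ℝ≥0∞) (l l' : List (MvPowerSeries σ ℝ≥0∞)) (n : ℕ) :
    trace (sizeDiag t * (downWord l * upWord l')) =
      (∏ k ∈ Finset.range n, cauchy l' (l.map (t ^ (k + 1) * ·))) *
        trace (sizeDiag t * (downWord (l.map (t ^ n * ·)) * upWord l')) := by
  induction n with
  | zero => simp
  | succ n ih =>
    rw [ih, trace_sizeDiag_mul_downWord_mul_upWord, List.map_map, Finset.prod_range_succ,
      mul_assoc]
    simp only [Function.comp_def, ← mul_assoc, ← pow_succ']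

theorem trace_sizeDiag_mul_upWord (t : MvPowerSeries σ ℝ≥0∞) (l : List (MvPowerSeries σ ℝ≥0∞))
    (n : ℕ) :
    trace (sizeDiag t * upWord l) = trace (sizeDiag t * upWord (l.map (t ^ n * ·))) := by
  induction n with
  | zero => simp
  | succ n ih =>
    rw [ih, trace_mul_comm, upWord_mul_sizeDiag, List.map_map]
    simp only [Function.comp_def, ← mul_assoc, ← pow_succ']

/-- The generating function of partitions with at most `K` parts. -/
theorem esum_pow_size (t : MvPowerSeries σ ℝ≥0∞) (K : ℕ) :
    (esum fun l : {lam : Ptn // lam.part K = 0} => t ^ l.1.size) =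
      ∏ k ∈ Finset.range K, geo (t ^ (k + 1)) := by
  induction K with
  | zero =>
    have h : ∀ l : {lam : Ptn // lam.part 0 = 0}, l.1.size = 0 := fun l => by
      rw [size_eq_sum l.2, Finset.sum_range_zero]
    have : Unique {lam : Ptn // lam.part 0 = 0} :=
      { default := ⟨ptnOf (fun _ => 0) (fun _ _ _ => le_rfl) ⟨0, rfl⟩, rfl⟩
        uniq := fun l => Subtype.ext (ptn_ext fun i => part_eq_zero_of_le l.2 i.zero_le) }
    rw [esum_unique, h, pow_zero, Finset.prod_range_zero]
  | succ K ih =>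
    rw [Finset.prod_range_succ, ← ih, mul_comm, geo, esum_mul]
    simp only [mul_esum]
    rw [← esum_prod fun (k : ℕ) (l : {lam : Ptn // lam.part K = 0}) =>
      (t ^ (K + 1)) ^ k * t ^ l.1.size, ← esum_equiv (columnEquiv K)]
    congr 1
    funext l
    rw [size_columnEquiv, pow_add, ← pow_mul, mul_comm (K + 1)]

theorem trace_sizeDiag_cong {m : σ →₀ ℕ} {t : MvPowerSeries σ ℝ≥0∞} {n : ℕ}
    (ht : Cong m (t ^ n) 0) :
    Cong m (trace (sizeDiag t)) (∏ k ∈ Finset.range n, geo (t ^ (k + 1))) := by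
  classical
  rw [← esum_pow_size]
  have h : (esum fun l : {lam : Ptn // lam.part n = 0} => t ^ l.1.size)
      = esum fun lam : Ptn => if lam.part n = 0 then t ^ lam.size else 0 := by
    rw [← esum_subtype (p := fun lam : Ptn => lam.part n = 0) fun lam hl => if_neg hl]
    congr 1
    funext l
    rw [if_pos l.2]
  rw [h]
  refine Cong.esum fun a => ?_
  rw [sizeDiag, if_pos rfl]
  split_ifs with ha
  · exact Cong.refl _
  · obtain ⟨d, hd⟩ := Nat.exists_eq_add_of_le (le_size_of_part_ne_zero ha).le
    rw [hd, pow_add]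
    exact ht.zero_mul _

theorem trace_cong {m : σ →₀ ℕ} {t : MvPowerSeries σ ℝ≥0∞} {n : ℕ} (ht : Cong m (t ^ n) 0)
    (l l' : List (MvPowerSeries σ ℝ≥0∞)) :
    Cong m (trace (sizeDiag t * (downWord l * upWord l')))
      (∏ k ∈ Finset.range n, cauchy l' (l.map (t ^ (k + 1) * ·)) * geo (t ^ (k + 1))) := by
  have hl : ∀ (l : List (MvPowerSeries σ ℝ≥0∞)), ∀ x ∈ l.map (t ^ n * ·), Cong m x 0 := by
    intro l x hx
    obtain ⟨y, -, rfl⟩ := List.mem_map.1 hx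
    exact ht.zero_mul y
  rw [trace_iterate t l l' n, Finset.prod_mul_distrib]
  refine (Cong.refl _).mul (Cong.trans ?_ (trace_sizeDiag_cong ht))
  have h1 := ((KCong.refl (sizeDiag t)).mul
    ((downWord_cong_one (hl l)).mul (KCong.refl (upWord l')))).trace
  rw [one_mul, trace_sizeDiag_mul_upWord t l' n] at h1
  refine h1.trans ?_
  have h2 := ((KCong.refl (sizeDiag t)).mul (upWord_cong_one (hl l'))).trace
  rwa [mul_one] at h2

/-- Moving all the `down` factors of a cylindric product to the left. -/
theorem prod_downWord_mul_upWord (lx ly : ℕ → List (MvPowerSeries σ ℝ≥0∞)) (h : ℕ) :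
    ((List.range h).map fun i => downWord (lx i) * upWord (ly i)).prod =
      (∏ j ∈ Finset.range h, ∏ i ∈ Finset.range j, cauchy (ly i) (lx j)) •
        (downWord ((List.range h).flatMap lx) * upWord ((List.range h).flatMap ly)) := by
  have hc : ∀ j l, cauchy ((List.range j).flatMap ly) l
      = ∏ i ∈ Finset.range j, cauchy (ly i) l := fun j l => by
    induction j with
    | zero => simp [cauchy]
    | succ j ih =>
      rw [List.range_succ, List.flatMap_append, cauchy_append_left, ih, Finset.prod_range_succ,
        List.flatMap_singleton]
  induction h with
  | zero => simp [downWord, upWord]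
  | succ h ih =>
    rw [List.prod_range_succ, ih, Finset.prod_range_succ, List.range_succ, List.flatMap_append,
      List.flatMap_append, List.flatMap_singleton, List.flatMap_singleton, downWord_append,
      upWord_append, smul_mul, mul_smul, ← hc]
    congr 1
    rw [mul_assoc, ← mul_assoc (upWord _) (downWord _), upWord_mul_downWord, smul_mul,
      mul_smul_comm]
    simp only [mul_assoc]

/-- Expansion of a product of kernels as a sum over paths. -/
theorem esum_path (h : ℕ) (A : ℕ → Kernel σ) (g : Ptn → Ptn → MvPowerSeries σ ℝ≥0∞) :
    (esum fun L : Fin (h + 1) → Ptn =>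
      g (L 0) (L (Fin.last h)) * ∏ i : Fin h, A i (L i.castSucc) (L i.succ)) =
    esum fun a => esum fun b => g a b * ((List.range h).map A).prod a b := by
  induction h generalizing g with
  | zero =>
    rw [← esum_equiv (Equiv.funUnique (Fin 1) Ptn).symm]
    congr 1
    funext a
    rw [esum_eq_single a fun b hb => by simp [one_apply, hb.symm]]
    simp [one_apply]
  | succ h ih =>
    rw [← esum_equiv (Fin.snocEquiv fun _ => Ptn)]
    rw [esum_prod fun b (L : Fin (h + 1) → Ptn) =>
      g ((Fin.snocEquiv fun _ => Ptn) (b, L) 0)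
          ((Fin.snocEquiv fun _ => Ptn) (b, L) (Fin.last (h + 1))) *
        ∏ i : Fin (h + 1), A i ((Fin.snocEquiv fun _ => Ptn) (b, L) i.castSucc)
          ((Fin.snocEquiv fun _ => Ptn) (b, L) i.succ), esum_comm]
    have key := ih fun a c => esum fun b => g a b * A h c b
    simp only [esum_mul] at key
    convert key using 1
    · congr 1
      funext L
      congr 1
      funext b
      have h0 : (Fin.snocEquiv fun _ => Ptn) (b, L) 0 = L 0 := by
        rw [← Fin.castSucc_zero, Fin.snocEquiv_apply, Fin.snoc_castSucc]
      have hs : ∀ i : Fin h, (Fin.snocEquiv fun _ => Ptn) (b, L) i.castSucc.succ = L i.succ :=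
        fun i => by rw [Fin.succ_castSucc, Fin.snocEquiv_apply, Fin.snoc_castSucc]
      rw [Fin.prod_univ_castSucc, h0]
      simp only [hs]
      simp only [Fin.snocEquiv_apply, Fin.snoc_castSucc, Fin.snoc_last, Fin.succ_last,
        Fin.val_castSucc, Fin.val_last]
      ring
    · congr 1
      funext a
      simp only [List.prod_range_succ, mul_apply, mul_esum]
      rw [esum_comm]
      congr 1
      funext b
      congr 1
      funext c
      ring

end Kernel

/-! ### Transfer between power series over `ℚ` and over `ℝ≥0∞` -/

/-- Up to the monomial `m`, the series `f` and `g` have the same natural coefficients. -/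
def Lift (m : σ →₀ ℕ) (f : MvPowerSeries σ ℚ) (g : MvPowerSeries σ ℝ≥0∞) : Prop :=
  ∃ p : MvPowerSeries σ ℕ, Cong m f (map (Nat.castRingHom ℚ) p) ∧
    Cong m g (map (Nat.castRingHom ℝ≥0∞) p)

namespace Lift

variable {m : σ →₀ ℕ} {f f' : MvPowerSeries σ ℚ} {g g' : MvPowerSeries σ ℝ≥0∞}

theorem exists_coeff (h : Lift m f g) {k : σ →₀ ℕ} (hk : k ≤ m) :
    ∃ n : ℕ, coeff k f = n ∧ coeff k g = n := by
  obtain ⟨p, h1, h2⟩ := h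
  exact ⟨coeff k p, by simpa using h1 k hk, by simpa using h2 k hk⟩

theorem of_coeff (h : ∀ k ≤ m, ∃ n : ℕ, coeff k f = n ∧ coeff k g = n) : Lift m f g := by
  choose! n hn using h
  exact ⟨n, fun k hk => (hn k hk).1, fun k hk => (hn k hk).2⟩

theorem zero : Lift m 0 0 := ⟨0, Cong.of_eq (by simp), Cong.of_eq (by simp)⟩

theorem one : Lift m 1 1 := ⟨1, Cong.of_eq (by simp), Cong.of_eq (by simp)⟩

theorem var (s : σ) : Lift m (X s) (X s) :=
  ⟨X s, Cong.of_eq (by simp), Cong.of_eq (by simp)⟩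

theorem add (h : Lift m f g) (h' : Lift m f' g') : Lift m (f + f') (g + g') := by
  obtain ⟨p, h1, h2⟩ := h
  obtain ⟨p', h1', h2'⟩ := h'
  exact ⟨p + p', by simpa using h1.add h1', by simpa using h2.add h2'⟩

theorem mul (h : Lift m f g) (h' : Lift m f' g') : Lift m (f * f') (g * g') := by
  obtain ⟨p, h1, h2⟩ := h
  obtain ⟨p', h1', h2'⟩ := h'
  exact ⟨p * p', by simpa using h1.mul h1', by simpa using h2.mul h2'⟩

theorem pow (h : Lift m f g) (n : ℕ) : Lift m (f ^ n) (g ^ n) := by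
  induction n with
  | zero => simpa using one
  | succ n ih => simpa [pow_succ] using ih.mul h

theorem sum {I : Type*} {f : I → MvPowerSeries σ ℚ} {g : I → MvPowerSeries σ ℝ≥0∞}
    (s : Finset I) (h : ∀ i ∈ s, Lift m (f i) (g i)) : Lift m (∑ i ∈ s, f i) (∑ i ∈ s, g i) := by
  classical
  induction s using Finset.induction_on with
  | empty => simpa using zero
  | insert a s ha ih =>
    rw [Finset.sum_insert ha, Finset.sum_insert ha]
    exact (h a (Finset.mem_insert_self _ _)).add
      (ih fun i hi => h i (Finset.mem_insert_of_mem hi))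

theorem prod {I : Type*} {f : I → MvPowerSeries σ ℚ} {g : I → MvPowerSeries σ ℝ≥0∞}
    (s : Finset I) (h : ∀ i ∈ s, Lift m (f i) (g i)) : Lift m (∏ i ∈ s, f i) (∏ i ∈ s, g i) := by
  classical
  induction s using Finset.induction_on with
  | empty => simpa using one
  | insert a s ha ih =>
    rw [Finset.prod_insert ha, Finset.prod_insert ha]
    exact (h a (Finset.mem_insert_self _ _)).mul
      (ih fun i hi => h i (Finset.mem_insert_of_mem hi))

theorem congr (h : Lift m f g) (hf : Cong m f' f) (hg : Cong m g' g) : Lift m f' g' := by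
  obtain ⟨p, h1, h2⟩ := h
  exact ⟨p, hf.trans h1, hg.trans h2⟩

theorem coeff_ne_top (h : Lift m f g) {k : σ →₀ ℕ} (hk : k ≤ m) : coeff k g ≠ ⊤ := by
  obtain ⟨n, -, hn⟩ := h.exists_coeff hk
  simp [hn]

theorem cong (h : Lift m f g) (h' : Lift m f' g') (hg : Cong m g g') : Cong m f f' :=
  fun k hk => by
    obtain ⟨n, h1, h2⟩ := h.exists_coeff hk
    obtain ⟨n', h1', h2'⟩ := h'.exists_coeff hk
    rw [h1, h1']
    have := hg k hk
    rw [h2, h2'] at this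
    exact_mod_cast this

theorem finite_support {I : Type*} {f : I → MvPowerSeries σ ℚ} {g : I → MvPowerSeries σ ℝ≥0∞}
    (hg : ∀ i, Lift m (f i) (g i)) {k : σ →₀ ℕ} (hk : k ≤ m) (hfin : coeff k (esum g) ≠ ⊤) :
    (Function.support fun i => coeff k (f i)).Finite := by
  rw [coeff_esum] at hfin
  refine (ENNReal.finite_const_le_of_tsum_ne_top hfin one_ne_zero).subset fun i hi => ?_
  obtain ⟨n, h1, h2⟩ := (hg i).exists_coeff hk
  have h0 : n ≠ 0 := by
    rintro rfl
    exact hi (by simpa using h1)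
  rw [Set.mem_ofPred_eq, h2]
  exact_mod_cast Nat.one_le_iff_ne_zero.2 h0

theorem tsum {I : Type*} {f : I → MvPowerSeries σ ℚ}
    (hf : ∀ m, ∃ g : I → MvPowerSeries σ ℝ≥0∞, (∀ i, Lift m (f i) (g i)) ∧
      ∀ k ≤ m, coeff k (esum g) ≠ ⊤)
    {g : I → MvPowerSeries σ ℝ≥0∞} (hg : ∀ i, Lift m (f i) (g i)) :
    Lift m (∑' i, f i) (esum g) := by
  classical
  have hs : ∀ k, (Function.support fun i => coeff k (f i)).Finite := fun k => by
    obtain ⟨g, hg, hfin⟩ := hf k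
    exact finite_support hg le_rfl (hfin k le_rfl)
  have hsum : HasSum f (fun k => ∑ i ∈ (hs k).toFinset, coeff k (f i)) := by
    refine Pi.hasSum.2 fun k => ?_
    exact hasSum_sum_of_ne_finset_zero (f := fun i => coeff k (f i)) fun i hi => by
      simpa using hi
  have : T2Space (MvPowerSeries σ ℚ) := inferInstanceAs (T2Space ((σ →₀ ℕ) → ℚ))
  rw [hsum.tsum_eq]
  refine of_coeff fun k hk => ?_
  choose n h1 h2 using fun i => (hg i).exists_coeff hk
  refine ⟨∑ i ∈ (hs k).toFinset, n i, ?_, ?_⟩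
  · change ∑ i ∈ (hs k).toFinset, coeff k (f i) = _
    simp [h1]
  · rw [coeff_esum, tsum_eq_sum (s := (hs k).toFinset) fun i hi => ?_]
    · simp [h2]
    · have : coeff k (f i) = 0 := by simpa using hi
      rw [h1] at this
      rw [h2]
      exact_mod_cast this

end Lift

theorem cong_tprod {I : Type*} {f : I → MvPowerSeries σ ℚ}
    (hf : ∀ m, ∃ S : Finset I, ∀ i ∉ S, Cong m (f i) 1) {m : σ →₀ ℕ} {S : Finset I}
    (hS : ∀ i ∉ S, Cong m (f i) 1) : Cong m (∏' i, f i) (∏ i ∈ S, f i) := by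
  classical
  choose T hT using hf
  have hprod : HasProd f (fun k => coeff k (∏ i ∈ T k, f i)) := by
    refine tendsto_pi_nhds.2 fun k => ?_
    refine tendsto_const_nhds.congr' ?_
    rw [SummationFilter.unconditional_filter]
    filter_upwards [Filter.eventually_ge_atTop (T k)] with s hs
    exact ((Cong.prod_subset hs fun i _ hi => hT k i hi) k le_rfl).symm
  have : T2Space (MvPowerSeries σ ℚ) := inferInstanceAs (T2Space ((σ →₀ ℕ) → ℚ))
  rw [hprod.tprod_eq]
  intro k hk
  change coeff k (∏ i ∈ T k, f i) = _
  rw [← (Cong.prod_subset (Finset.subset_union_left (s₂ := S)) fun i _ hi => hT k i hi) k le_rfl,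
    (Cong.prod_subset (Finset.subset_union_right (s₁ := T k)) fun i _ hi => hS i hi) k hk]

/-! ### Inverses of `1 - a` -/

theorem inv_cong_one {m : σ →₀ ℕ} {a : MvPowerSeries σ ℚ} (h0 : constantCoeff a = 0)
    (ha : Cong m a 0) : Cong m (1 - a)⁻¹ 1 := by
  have h1 : constantCoeff (1 - a) ≠ 0 := by simp [h0]
  have h : (1 - a)⁻¹ = 1 + (1 - a)⁻¹ * a := by
    linear_combination MvPowerSeries.inv_mul_cancel (1 - a) h1
  rw [h]
  exact ((Cong.refl _).add (ha.mul_zero _)).trans (Cong.of_eq (add_zero 1))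

theorem Lift.inv {m : σ →₀ ℕ} {a : MvPowerSeries σ ℚ} {b : MvPowerSeries σ ℝ≥0∞}
    (h0 : constantCoeff a = 0) (hb : constantCoeff b = 0) (h : Lift m a b) :
    Lift m (1 - a)⁻¹ (geo b) := by
  have h1 : constantCoeff (1 - a) ≠ 0 := by simp [h0]
  set d := m.degree + 1
  refine (Lift.sum (Finset.range d) fun n _ => h.pow n).congr ?_
    (geo_cong_sum m fun n hn => pow_cong_zero m hb hn)
  have hs : (1 - a)⁻¹ = (∑ n ∈ Finset.range d, a ^ n) + (1 - a)⁻¹ * a ^ d := by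
    linear_combination (∑ n ∈ Finset.range d, a ^ n) * MvPowerSeries.inv_mul_cancel (1 - a) h1 -
      (1 - a)⁻¹ * geom_sum_mul_neg a d
  rw [hs]
  exact ((Cong.refl _).add ((pow_cong_zero m h0 (Nat.lt_succ_self _)).mul_zero _)).trans
    (Cong.of_eq (add_zero _))

/-! ### Skew Schur functions as matrix entries -/

theorem chainWeight_eq_prod {R : Type*} [CommRing R] (X : ℕ → R) {c : ℕ → Ptn} {lam : Ptn}
    {N : ℕ} (hc : ∀ i, N ≤ i → c i = lam) :
    chainWeight X c = ∏ i ∈ Finset.range N, X i ^ ((c (i + 1)).size - (c i).size) := by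
  refine finprod_eq_prod_of_mulSupport_subset _ fun i hi => ?_
  rw [Finset.coe_range, Set.mem_Iio]
  by_contra h
  have h := not_lt.1 h
  exact hi (by beta_reduce; rw [hc i h, hc (i + 1) (by lia), Nat.sub_self, pow_zero])

open Classical in
/-- The weight of a chain stabilizing at `lam` after `N` steps, and zero for other chains. -/
noncomputable def truncWeight (x : ℕ → MvPowerSeries σ ℝ≥0∞) (lam : Ptn) (N : ℕ)
    (c : ℕ → Ptn) : MvPowerSeries σ ℝ≥0∞ :=
  if ∀ i, N ≤ i → c i = lam then
    ∏ i ∈ Finset.range N, x i ^ ((c (i + 1)).size - (c i).size) else 0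

theorem lift_chainWeight (v : ℕ → σ) {m : σ →₀ ℕ} {N : ℕ} (hN : ∀ i, N ≤ i → m (v i) = 0)
    {lam mu : Ptn} {c : ℕ → Ptn} (hc : IsSchurChain mu lam c) :
    Lift m (chainWeight (fun i => (X (v i) : MvPowerSeries σ ℚ)) c)
      (truncWeight (fun i => X (v i)) lam N c) := by
  rw [truncWeight]
  split_ifs with h
  · rw [chainWeight_eq_prod _ h]
    exact Lift.prod _ fun i _ => (Lift.var _).pow _
  · obtain ⟨M, hM⟩ := hc.2.2
    obtain ⟨j, hj, hne⟩ : ∃ j, N ≤ j ∧ c j ≠ c (j + 1) := by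
      by_contra! hall
      refine h fun i hi => ?_
      have hconst : ∀ d, c i = c (i + d) := fun d => by
        induction d with
        | zero => rfl
        | succ d ih => exact ih.trans (hall _ (by lia))
      rw [hconst M, hM _ (by lia)]
    have hjM : j < M := by
      by_contra hjM
      exact hne (by rw [hM j (by lia), hM (j + 1) (by lia)])
    rw [chainWeight_eq_prod _ hM]
    refine Lift.zero.congr ?_ (Cong.refl 0)
    rw [← Finset.mul_prod_erase _ _ (Finset.mem_range.2 hjM)]
    refine Cong.zero_mul (X_pow_cong_zero m (v j) ?_) _
    rw [hN j hj]
    have := fun hs => hne (eq_of_hStrip_of_size_le (hc.2.1 j) hs)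
    lia

theorem esum_truncWeight (x : ℕ → MvPowerSeries σ ℝ≥0∞) (lam mu : Ptn) (N : ℕ) :
    (esum fun c : {c : ℕ → Ptn // IsSchurChain mu lam c} => truncWeight x lam N c.1) =
      Kernel.upWord ((List.range N).map x) mu lam := by
  classical
  have hpath := Kernel.esum_path N (fun i => Kernel.up (x i))
    (fun a b => if a = mu ∧ b = lam then 1 else 0)
  rw [esum_eq_single (f := fun a => esum fun b => _) mu fun a ha => ?_,
    esum_eq_single lam fun b hb => ?_, if_pos ⟨rfl, rfl⟩, one_mul] at hpath
  rotate_left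
  · rw [if_neg fun h => hb h.2, zero_mul]
  · simp only [if_neg fun h : a = mu ∧ _ => ha h.1, zero_mul]
    ext; simp [coeff_esum]
  rw [Kernel.upWord, List.map_map]
  refine Eq.trans ?_ hpath
  rw [← esum_subtype (p := fun c : {c : ℕ → Ptn // IsSchurChain mu lam c} =>
    ∀ i, N ≤ i → c.1 i = lam) fun c hc => by rw [truncWeight, if_neg hc]]
  rw [← esum_injective (e := fun (c : {c : {c : ℕ → Ptn // IsSchurChain mu lam c} //
    ∀ i, N ≤ i → c.1 i = lam}) (j : Fin (N + 1)) => c.1.1 j)]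
  · congr 1
    funext c
    rw [truncWeight, if_pos c.2, if_pos ⟨c.1.2.1, c.2 _ le_rfl⟩, one_mul, Finset.prod_range]
    refine Finset.prod_congr rfl fun i _ => ?_
    exact (if_pos (c.1.2.2.1 i)).symm
  · intro c c' h
    refine Subtype.ext (Subtype.ext (funext fun i => ?_))
    by_cases hi : i < N + 1
    · exact congrFun h ⟨i, hi⟩
    · rw [c.2 i (by lia), c'.2 i (by lia)]
  · intro L hL
    by_contra hne
    have h1 : L 0 = mu ∧ L (Fin.last N) = lam := by
      by_contra h
      exact hne (by rw [if_neg h, zero_mul])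
    have h2 : ∀ i : Fin N, HStrip (L i.castSucc) (L i.succ) := fun i => by
      by_contra h
      refine hne ?_
      rw [Finset.prod_eq_zero (Finset.mem_univ i) (if_neg h), mul_zero]
    have hlast : ∀ i, (hi : N ≤ i) → L ⟨min i N, by lia⟩ = lam := fun i hi => by
      rw [← h1.2]
      congr 1
      exact Fin.ext (min_eq_right hi)
    refine hL ⟨⟨⟨fun i => L ⟨min i N, by lia⟩, ?_, fun i => ?_, N, hlast⟩, hlast⟩, ?_⟩
    · rw [← h1.1]
      exact congrArg L (Fin.ext (Nat.zero_min N))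
    · by_cases hi : i < N
      · have h3 := h2 ⟨i, hi⟩
        convert h3 using 2 <;> apply Fin.ext <;> simp <;> lia
      · beta_reduce
        rw [hlast i (by lia), hlast (i + 1) (by lia)]
        exact hStrip_refl lam
    · funext j
      simp only
      congr 1
      exact Fin.ext (min_eq_left (by lia))

theorem coeff_mul_ne_top {f g : MvPowerSeries σ ℝ≥0∞} (hf : ∀ k, coeff k f ≠ ⊤)
    (hg : ∀ k, coeff k g ≠ ⊤) (k : σ →₀ ℕ) : coeff k (f * g) ≠ ⊤ := by
  classical
  rw [coeff_mul]
  exact ENNReal.sum_ne_top.2 fun p _ => ENNReal.mul_ne_top (hf _) (hg _)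

theorem coeff_upWord_ne_top (v : ℕ → σ) (N : ℕ) (mu lam : Ptn) (k : σ →₀ ℕ) :
    coeff k (Kernel.upWord ((List.range N).map fun i => X (v i)) mu lam) ≠ ⊤ := by
  classical
  induction N generalizing lam k with
  | zero =>
    rw [List.range_zero, List.map_nil, Kernel.upWord, List.map_nil, List.prod_nil,
      Kernel.one_apply]
    split_ifs
    · rw [coeff_one]
      split_ifs <;> simp
    · simp
  | succ N ih =>
    rw [List.range_succ, List.map_append, Kernel.upWord_append, Kernel.mul_apply, coeff_esum,
      tsum_eq_sum (s := (finite_hStrip lam).toFinset) fun nu hnu => ?_]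
    · refine ENNReal.sum_ne_top.2 fun nu _ => coeff_mul_ne_top (ih nu) (fun k => ?_) k
      rw [List.map_singleton, Kernel.upWord, List.map_singleton, List.prod_singleton, Kernel.up]
      split_ifs
      · rw [coeff_X_pow]
        split_ifs <;> simp
      · simp
    · rw [List.map_singleton, Kernel.upWord, Kernel.upWord, List.map_singleton,
        List.prod_singleton, Kernel.up, if_neg (by simpa using hnu), mul_zero, map_zero]

theorem exists_forall_apply_eq_zero {v : ℕ → σ} (hv : v.Injective) (m : σ →₀ ℕ) :
    ∃ N, ∀ i, N ≤ i → m (v i) = 0 := by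
  obtain ⟨N, hN⟩ := (m.support.finite_toSet.preimage hv.injOn).bddAbove
  refine ⟨N + 1, fun i hi => ?_⟩
  by_contra h
  have : i ≤ N := hN (by simpa using h)
  lia

theorem lift_skewSchur {v : ℕ → σ} (hv : v.Injective) {m : σ →₀ ℕ} {N : ℕ}
    (hN : ∀ i, N ≤ i → m (v i) = 0) (lam mu : Ptn) :
    Lift m (skewSchur (fun i => (X (v i) : MvPowerSeries σ ℚ)) lam mu)
      (Kernel.upWord ((List.range N).map fun i => X (v i)) mu lam) := by
  rw [← esum_truncWeight]
  refine Lift.tsum (fun m' => ?_) fun c => lift_chainWeight v hN c.2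
  obtain ⟨M, hM⟩ := exists_forall_apply_eq_zero hv m'
  refine ⟨_, fun c => lift_chainWeight v hM c.2, fun k _ => ?_⟩
  rw [esum_truncWeight]
  exact coeff_upWord_ne_top v M mu lam k

/-! ### The Cauchy kernel -/

theorem cong_Psi {A B : ℕ → MvPowerSeries σ ℚ} (hA0 : ∀ i, constantCoeff (A i) = 0)
    (hA : ∀ m, ∃ N, ∀ i, N ≤ i → Cong m (A i) 0) (hB : ∀ m, ∃ N, ∀ i, N ≤ i → Cong m (B i) 0)
    {m : σ →₀ ℕ} {N M : ℕ} (hN : ∀ i, N ≤ i → Cong m (A i) 0)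
    (hM : ∀ i, M ≤ i → Cong m (B i) 0) :
    Cong m (Psi A B) (∏ p ∈ Finset.range N ×ˢ Finset.range M, (1 - A p.1 * B p.2)⁻¹) := by
  have key : ∀ {m : σ →₀ ℕ} {N M : ℕ}, (∀ i, N ≤ i → Cong m (A i) 0) →
      (∀ i, M ≤ i → Cong m (B i) 0) → ∀ p ∉ Finset.range N ×ˢ Finset.range M,
      Cong m (1 - A p.1 * B p.2)⁻¹ 1 := by
    intro m N M hN hM p hp
    refine inv_cong_one (by simp [hA0]) ?_
    rw [Finset.mem_product, Finset.mem_range, Finset.mem_range, not_and_or, not_lt, not_lt] at hp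
    rcases hp with hp | hp
    · exact (hN _ hp).zero_mul _
    · exact (hM _ hp).mul_zero _
  refine cong_tprod (fun m => ?_) (key hN hM)
  obtain ⟨N, hN⟩ := hA m
  obtain ⟨M, hM⟩ := hB m
  exact ⟨_, key hN hM⟩

theorem lift_Psi {A B : ℕ → MvPowerSeries σ ℚ} {A' B' : ℕ → MvPowerSeries σ ℝ≥0∞}
    (hA0 : ∀ i, constantCoeff (A i) = 0) (hA0' : ∀ i, constantCoeff (A' i) = 0)
    (hA : ∀ m, ∃ N, ∀ i, N ≤ i → Cong m (A i) 0) (hB : ∀ m, ∃ N, ∀ i, N ≤ i → Cong m (B i) 0)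
    {m : σ →₀ ℕ} {N M : ℕ} (hN : ∀ i, N ≤ i → Cong m (A i) 0)
    (hM : ∀ i, M ≤ i → Cong m (B i) 0) (hAA : ∀ i, Lift m (A i) (A' i))
    (hBB : ∀ i, Lift m (B i) (B' i)) :
    Lift m (Psi A B) (∏ i ∈ Finset.range N, ∏ j ∈ Finset.range M, geo (A' i * B' j)) := by
  refine Lift.congr ?_ (cong_Psi hA0 hA hB hN hM) (Cong.of_eq (Finset.prod_product' _ _ _).symm)
  exact Lift.prod _ fun p _ => Lift.inv (by simp [hA0]) (by simp [hA0']) ((hAA _).mul (hBB _))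

/-! ### Reindexing products -/

theorem prod_range_mod_div {M : Type*} [CommMonoid M] (F : ℕ → ℕ → M) {h : ℕ} (hh : h ≠ 0)
    (N : ℕ) : ∏ r ∈ Finset.range (h * N), F (r % h) (r / h) =
      ∏ i ∈ Finset.range h, ∏ a ∈ Finset.range N, F i a := by
  induction N with
  | zero => simp
  | succ N ih =>
    rw [Nat.mul_succ, Finset.prod_range_add, ih]
    simp only [Finset.prod_range_succ, Finset.prod_mul_distrib]
    congr 1
    refine Finset.prod_congr rfl fun i hi => ?_
    have hi := Finset.mem_range.1 hi
    rw [Nat.mul_add_mod, Nat.mod_eq_of_lt hi, Nat.mul_add_div (Nat.pos_of_ne_zero hh),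
      Nat.div_eq_of_lt hi, add_zero]

theorem prod_map_range {M : Type*} [CommMonoid M] (F : ℕ → M) (N : ℕ) :
    ((List.range N).map F).prod = ∏ a ∈ Finset.range N, F a := by
  induction N with
  | zero => simp
  | succ N ih => rw [List.prod_range_succ, ih, Finset.prod_range_succ]

theorem prod_map_flatMap_range {M α : Type*} [CommMonoid M] (F : α → M) (l : ℕ → List α) (h : ℕ) :
    (((List.range h).flatMap l).map F).prod = ∏ i ∈ Finset.range h, ((l i).map F).prod := by
  induction h with
  | zero => simp
  | succ h ih =>
    rw [List.range_succ, List.flatMap_append, List.map_append, List.prod_append, ih,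
      Finset.prod_range_succ, List.flatMap_singleton]

theorem prod_map_reverse_map_range {M α : Type*} [CommMonoid M] (F : α → M) (x : ℕ → α) (N : ℕ) :
    ((((List.range N).map x).reverse).map F).prod = ∏ a ∈ Finset.range N, F (x a) := by
  rw [((List.reverse_perm _).map F).prod_eq, List.map_map, prod_map_range]
  rfl

theorem prod_filter_lt {M : Type*} [CommMonoid M] (F : ℕ → ℕ → M) (h : ℕ) :
    ∏ q ∈ Finset.univ.filter (fun q : Fin h × Fin h => q.1 < q.2), F q.1 q.2 =
      ∏ j ∈ Finset.range h, ∏ i ∈ Finset.range j, F i j := by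
  rw [Finset.prod_filter, ← Finset.univ_product_univ, Finset.prod_product_right, Finset.prod_range]
  refine Finset.prod_congr rfl fun j _ => ?_
  have hj : Finset.range j = (Finset.range h).filter (· < (j : ℕ)) := by
    ext i
    simp only [Finset.mem_range, Finset.mem_filter]
    lia
  rw [hj, Finset.prod_filter, Finset.prod_range]
  rfl

namespace Kernel

theorem cauchy_map_reverse_map (x y : ℕ → MvPowerSeries σ ℝ≥0∞) (N : ℕ) :
    cauchy ((List.range N).map y) ((List.range N).map x).reverse =
      ∏ a ∈ Finset.range N, ∏ b ∈ Finset.range N, geo (y a * x b) := by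
  rw [cauchy, List.map_map, prod_map_range]
  exact Finset.prod_congr rfl fun a _ => prod_map_reverse_map_range _ x N

theorem cauchy_flatMap (t : MvPowerSeries σ ℝ≥0∞) (x y : ℕ → ℕ → MvPowerSeries σ ℝ≥0∞)
    (h N : ℕ) :
    cauchy ((List.range h).flatMap fun i => (List.range N).map (y i))
        (((List.range h).flatMap fun i => ((List.range N).map (x i)).reverse).map (t * ·)) =
      ∏ j ∈ Finset.range h, ∏ b ∈ Finset.range N, ∏ i ∈ Finset.range h, ∏ a ∈ Finset.range N,
        geo (t * x j b * y i a) := by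
  simp only [cauchy, prod_map_flatMap_range, prod_map_reverse_map_range, List.map_map,
    prod_map_range, Function.comp_apply]
  rw [Finset.prod_congr rfl fun i _ => Finset.prod_comm, Finset.prod_comm]
  refine Finset.prod_congr rfl fun j _ => ?_
  rw [Finset.prod_congr rfl fun i _ => Finset.prod_comm, Finset.prod_comm]
  simp only [mul_comm (y _ _)]

/-- The cylindric sum is the trace of a product of kernels. -/
theorem esum_cylindric (t : MvPowerSeries σ ℝ≥0∞) (lx ly : ℕ → List (MvPowerSeries σ ℝ≥0∞))
    (h : ℕ) :
    (esum fun p : {L : Fin (h + 1) → Ptn // L 0 = L (Fin.last h)} × (Fin h → Ptn) =>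
      t ^ (p.1.1 (Fin.last h)).size *
        ∏ i : Fin h, downWord (lx i) (p.1.1 i.castSucc) (p.2 i) *
          upWord (ly i) (p.2 i) (p.1.1 i.succ)) =
      trace (sizeDiag t * ((List.range h).map fun i => downWord (lx i) * upWord (ly i)).prod) := by
  classical
  rw [esum_prod fun (L : {L : Fin (h + 1) → Ptn // L 0 = L (Fin.last h)}) (M : Fin h → Ptn) =>
    t ^ (L.1 (Fin.last h)).size * ∏ i : Fin h, downWord (lx i) (L.1 i.castSucc) (M i) *
      upWord (ly i) (M i) (L.1 i.succ)]
  have hM : ∀ L : {L : Fin (h + 1) → Ptn // L 0 = L (Fin.last h)},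
      (esum fun M : Fin h → Ptn => t ^ (L.1 (Fin.last h)).size *
        ∏ i : Fin h, downWord (lx i) (L.1 i.castSucc) (M i) * upWord (ly i) (M i) (L.1 i.succ)) =
      (if L.1 0 = L.1 (Fin.last h) then t ^ (L.1 (Fin.last h)).size else 0) *
        ∏ i : Fin h, (downWord (lx i) * upWord (ly i)) (L.1 i.castSucc) (L.1 i.succ) := fun L => by
    rw [← mul_esum, ← prod_esum h fun i c =>
      downWord (lx i) (L.1 i.castSucc) c * upWord (ly i) c (L.1 i.succ), if_pos L.2]
    rfl
  simp only [hM]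
  rw [esum_subtype (p := fun L : Fin (h + 1) → Ptn => L 0 = L (Fin.last h))
    (f := fun L => (if L 0 = L (Fin.last h) then t ^ (L (Fin.last h)).size else 0) *
        ∏ i : Fin h, (downWord (lx i) * upWord (ly i)) (L i.castSucc) (L i.succ))
    fun L hL => by rw [if_neg hL, zero_mul]]
  rw [esum_path h (fun i => downWord (lx i) * upWord (ly i))
    fun a b => if a = b then t ^ b.size else 0, trace]
  congr 1
  funext a
  rw [esum_eq_single a fun b hb => by rw [if_neg hb.symm, zero_mul], if_pos rfl,
    sizeDiag_mul_apply]

theorem trace_cylindric_cong {m : σ →₀ ℕ} {t : MvPowerSeries σ ℝ≥0∞} {n : ℕ}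
    (ht : Cong m (t ^ n) 0) (x y : ℕ → ℕ → MvPowerSeries σ ℝ≥0∞) (h N : ℕ) :
    Cong m (trace (sizeDiag t * ((List.range h).map fun i =>
        downWord ((List.range N).map (x i)).reverse * upWord ((List.range N).map (y i))).prod))
      ((∏ q ∈ Finset.univ.filter (fun q : Fin h × Fin h => q.1 < q.2),
          ∏ a ∈ Finset.range N, ∏ b ∈ Finset.range N, geo (y q.1 a * x q.2 b)) *
        ∏ k ∈ Finset.range n, (∏ j ∈ Finset.range h, ∏ b ∈ Finset.range N,
          ∏ i ∈ Finset.range h, ∏ a ∈ Finset.range N, geo (t ^ (k + 1) * x j b * y i a)) *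
            geo (t ^ (k + 1))) := by
  rw [prod_downWord_mul_upWord (fun i => ((List.range N).map (x i)).reverse)
    (fun i => (List.range N).map (y i)), mul_smul_comm, trace_smul,
    prod_filter_lt fun i j => ∏ a ∈ Finset.range N, ∏ b ∈ Finset.range N, geo (y i a * x j b)]
  simp only [cauchy_map_reverse_map, ← cauchy_flatMap]
  exact (Cong.refl _).mul (trace_cong ht _ _)

end Kernel

/-! ### The cylindric alphabets -/

theorem cong_X_zero {R : Type*} [CommSemiring R] {m : σ →₀ ℕ} {s : σ} (h : m s = 0) :
    Cong m (X s : MvPowerSeries σ R) 0 := by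
  simpa using X_pow_cong_zero (R := R) m s (n := 1) (by lia)

theorem exists_bound (m : (Bool × ℕ × ℕ) ⊕ Unit →₀ ℕ) :
    ∃ N, ∀ b i n, N ≤ n → m (Sum.inl (b, i, n)) = 0 := by
  obtain ⟨N, hN⟩ := ((m.support.finite_toSet).image
    (Sum.elim (fun q : Bool × ℕ × ℕ => q.2.2) fun _ : Unit => 0)).bddAbove
  refine ⟨N + 1, fun b i n hn => ?_⟩
  by_contra h
  have : n ≤ N := hN ⟨Sum.inl (b, i, n), by simpa using h, rfl⟩
  lia

/-- The union of the alphabets `A 0, …, A (h - 1)` over an arbitrary semiring. -/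
def union {R : Type*} [Zero R] (h : ℕ) (A : ℕ → ℕ → R) (n : ℕ) : R :=
  if h = 0 then 0 else A (n % h) (n / h)

theorem prod_union {R M : Type*} [Zero R] [CommMonoid M] (h : ℕ) (A : ℕ → ℕ → R) (F : R → M)
    (N : ℕ) : ∏ r ∈ Finset.range (h * N), F (union h A r) =
      ∏ i ∈ Finset.range h, ∏ a ∈ Finset.range N, F (A i a) := by
  rcases eq_or_ne h 0 with rfl | hh
  · simp
  · simp only [union, if_neg hh]
    exact prod_range_mod_div (fun i a => F (A i a)) hh N

theorem union_induction {R : Type*} [Zero R] {h : ℕ} {A : ℕ → ℕ → R} {p : R → Prop} {n N : ℕ}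
    (hn : h * N ≤ n) (h0 : p 0) (hA : ∀ i a, N ≤ a → p (A i a)) : p (union h A n) := by
  rw [union]
  split_ifs with hh
  · exact h0
  · exact hA _ _ ((Nat.le_div_iff_mul_le (Nat.pos_of_ne_zero hh)).2 (mul_comm h N ▸ hn))

/-- The cylindric summation formula up to a given monomial, with its two sides compared through
a sum of series over `ℝ≥0∞`. -/
theorem exists_lift_cylindric (h : ℕ) (m : (Bool × ℕ × ℕ) ⊕ Unit →₀ ℕ) :
    ∃ g : {L : Fin (h + 1) → Ptn // L 0 = L (Fin.last h)} × (Fin h → Ptn) →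
        MvPowerSeries ((Bool × ℕ × ℕ) ⊕ Unit) ℝ≥0∞,
      (∀ p, Lift m (z ^ (p.1.1 (Fin.last h)).size * ∏ i : Fin h,
        skewSchur (Xa i) (p.1.1 i.castSucc) (p.2 i) *
          skewSchur (Ya i) (p.1.1 i.succ) (p.2 i)) (g p)) ∧
      ∃ r, Cong m (esum g) r ∧
        Lift m ((∏ q ∈ Finset.univ.filter (fun q : Fin h × Fin h => q.1 < q.2),
          Psi (Ya q.1) (Xa q.2)) * ∏' k : ℕ,
            Psi (fun n => z ^ (k + 1) * unionA h Xa n) (unionA h Ya) * (1 - z ^ (k + 1))⁻¹) r := by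
  obtain ⟨N, hN⟩ := exists_bound m
  let x : ℕ → ℕ → MvPowerSeries ((Bool × ℕ × ℕ) ⊕ Unit) ℝ≥0∞ :=
    fun i n => X (Sum.inl (false, i, n))
  let y : ℕ → ℕ → MvPowerSeries ((Bool × ℕ × ℕ) ⊕ Unit) ℝ≥0∞ :=
    fun i n => X (Sum.inl (true, i, n))
  let t : MvPowerSeries ((Bool × ℕ × ℕ) ⊕ Unit) ℝ≥0∞ := X (Sum.inr ())
  have hinj : ∀ b i, Function.Injective
      fun n => (Sum.inl (b, i, n) : (Bool × ℕ × ℕ) ⊕ Unit) := fun b i n n' h => by simpa using h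
  set n := m (Sum.inr ()) + 1
  have ht : Cong m (t ^ n) 0 := X_pow_cong_zero m _ (Nat.lt_succ_self _)
  have htk : ∀ k, n ≤ k → Cong m (z ^ (k + 1)) 0 := fun k hk =>
    X_pow_cong_zero m _ (by lia)
  refine ⟨fun p => t ^ (p.1.1 (Fin.last h)).size * ∏ i : Fin h,
    Kernel.downWord ((List.range N).map (x i)).reverse (p.1.1 i.castSucc) (p.2 i) *
      Kernel.upWord ((List.range N).map (y i)) (p.2 i) (p.1.1 i.succ), fun p => ?_, _,
    (Cong.of_eq (Kernel.esum_cylindric t (fun i => ((List.range N).map (x i)).reverse)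
      (fun i => (List.range N).map (y i)) h)).trans
        (Kernel.trace_cylindric_cong ht x y h N), ?_⟩
  · refine ((Lift.var _).pow _).mul (Lift.prod _ fun i _ => ?_)
    rw [Kernel.downWord_reverse_apply]
    exact (lift_skewSchur (hinj false i) (hN false i) _ _).mul
      (lift_skewSchur (hinj true i) (hN true i) _ _)
  · have hvar : ∀ b i (m : (Bool × ℕ × ℕ) ⊕ Unit →₀ ℕ), ∃ N, ∀ n, N ≤ n →
        Cong m (X (Sum.inl (b, i, n)) : R2) 0 := fun b i m => by
      obtain ⟨N, hN⟩ := exists_bound m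
      exact ⟨N, fun n hn => cong_X_zero (hN b i n hn)⟩
    have hX0 : ∀ r, constantCoeff (unionA h Xa r) = 0 := fun r =>
      union_induction (A := Xa) (p := fun a => constantCoeff a = 0) (Nat.mul_zero h ▸ Nat.zero_le r)
        (map_zero _)
        fun i a _ => constantCoeff_X _
    have hx0 : ∀ r, constantCoeff (union h x r) = 0 := fun r =>
      union_induction (A := x) (p := fun a => constantCoeff a = 0) (Nat.mul_zero h ▸ Nat.zero_le r)
        (map_zero _)
        fun i a _ => constantCoeff_X _
    have hXm : ∀ {m : (Bool × ℕ × ℕ) ⊕ Unit →₀ ℕ} {N : ℕ},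
        (∀ b i n, N ≤ n → m (Sum.inl (b, i, n)) = 0) →
        ∀ r, h * N ≤ r → Cong m (unionA h Xa r) 0 := fun hN r hr =>
      union_induction (A := Xa) (p := fun a => Cong _ a 0) hr (Cong.refl 0)
        fun i a ha => cong_X_zero (hN _ _ _ ha)
    have hYm : ∀ {m : (Bool × ℕ × ℕ) ⊕ Unit →₀ ℕ} {N : ℕ},
        (∀ b i n, N ≤ n → m (Sum.inl (b, i, n)) = 0) →
        ∀ r, h * N ≤ r → Cong m (unionA h Ya r) 0 := fun hN r hr =>
      union_induction (A := Ya) (p := fun a => Cong _ a 0) hr (Cong.refl 0)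
        fun i a ha => cong_X_zero (hN _ _ _ ha)
    have hlift : ∀ (A : ℕ → ℕ → R2) A', (∀ i a, Lift m (A i a) (A' i a)) →
        ∀ r, Lift m (unionA h A r) (union h A' r) := fun A A' hA r => by
      rw [unionA, union]
      split_ifs
      · exact Lift.zero
      · exact hA _ _
    have hA0 : ∀ k r, constantCoeff (z ^ (k + 1) * unionA h Xa r) = 0 := fun k r => by
      rw [map_mul, hX0, mul_zero]
    have hA : ∀ k, ∀ m, ∃ N, ∀ r, N ≤ r → Cong m (z ^ (k + 1) * unionA h Xa r) 0 := fun k m => by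
      obtain ⟨N, hN⟩ := exists_bound m
      exact ⟨h * N, fun r hr => (hXm hN r hr).mul_zero _⟩
    have hB : ∀ m, ∃ N, ∀ r, N ≤ r → Cong m (unionA h Ya r) 0 := fun m => by
      obtain ⟨N, hN⟩ := exists_bound m
      exact ⟨h * N, hYm hN⟩
    have hz0 : ∀ k, constantCoeff (z ^ (k + 1)) = 0 := fun k => by
      rw [map_pow, z, constantCoeff_X, zero_pow k.succ_ne_zero]
    have ht0 : ∀ k, constantCoeff (t ^ (k + 1)) = 0 := fun k => by
      rw [map_pow, constantCoeff_X, zero_pow k.succ_ne_zero]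
    have hone : ∀ {m : (Bool × ℕ × ℕ) ⊕ Unit →₀ ℕ} {k : ℕ}, Cong m (z ^ (k + 1)) 0 →
        Cong m (Psi (fun n => z ^ (k + 1) * unionA h Xa n) (unionA h Ya) *
          (1 - z ^ (k + 1))⁻¹) 1 := fun {m k} hk => by
      obtain ⟨M, hM⟩ := hB m
      have h1 := cong_Psi (hA0 k) (hA k) hB (N := 0) (fun r _ => hk.zero_mul _) hM
      rw [Finset.range_zero, Finset.empty_product, Finset.prod_empty] at h1
      exact (h1.mul (inv_cong_one (hz0 k) hk)).trans (Cong.of_eq (mul_one 1))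
    refine Lift.mul (Lift.prod _ fun q _ => ?_) ?_
    · exact lift_Psi (fun _ => constantCoeff_X _) (fun _ => constantCoeff_X _)
        (hvar true q.1) (hvar false q.2) (fun r hr => cong_X_zero (hN _ _ _ hr))
        (fun r hr => cong_X_zero (hN _ _ _ hr)) (fun _ => Lift.var _) fun _ => Lift.var _
    · refine Lift.congr (Lift.prod (Finset.range n) fun k _ => ?_)
        (cong_tprod (fun m => ?_) fun k hk => hone (htk k (by simpa using hk))) (Cong.refl _)
      · refine Lift.mul ?_ (Lift.inv (hz0 k) (ht0 k) ((Lift.var _).pow _))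
        refine (lift_Psi (A' := fun r => t ^ (k + 1) * union h x r) (B' := union h y)
          (hA0 k) (fun r => by rw [map_mul, hx0, mul_zero]) (hA k) hB
          (fun r hr => (hXm hN r hr).mul_zero _) (hYm hN)
          (fun r => ((Lift.var _).pow _).mul (hlift Xa x (fun _ _ => Lift.var _) r))
          (hlift Ya y fun _ _ => Lift.var _)).congr (Cong.refl _) (Cong.of_eq ?_)
        rw [prod_union h x fun a => ∏ s ∈ Finset.range (h * N),
          geo (t ^ (k + 1) * a * union h y s)]
        exact Finset.prod_congr rfl fun j _ => Finset.prod_congr rfl fun b _ =>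
          (prod_union h y (fun c => geo (t ^ (k + 1) * x j b * c)) N).symm
      · refine ⟨Finset.range (m (Sum.inr ()) + 1), fun k hk => hone ?_⟩
        rw [Finset.mem_range, not_lt] at hk
        exact X_pow_cong_zero m _ (by lia)

end Cylindric

/-- **Cylindric summation formula** for skew Schur functions (Theorem 2.2,
equation (2.6)):
`Σ_{λ^0=λ^h} Σ_{μ^0,…,μ^{h-1}} z^{|λ^h|} ∏_i s_{λ^i/μ^i}(X^i) s_{λ^{i+1}/μ^i}(Y^i)
  = ∏_{0≤i<j≤h-1} Ψ(Y^i, X^j) · ∏_{k≥1} Ψ(z^k X, Y)/(1-z^k)`. -/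
theorem cylindric_summation_formula (h : ℕ) :
    ∑' p : {L : Fin (h + 1) → Ptn // L 0 = L (Fin.last h)} × (Fin h → Ptn),
      z ^ (p.1.1 (Fin.last h)).size *
        ∏ i : Fin h,
          skewSchur (Xa i) (p.1.1 i.castSucc) (p.2 i) * skewSchur (Ya i) (p.1.1 i.succ) (p.2 i)
    = (∏ q ∈ Finset.univ.filter (fun q : Fin h × Fin h => q.1 < q.2), Psi (Ya q.1) (Xa q.2)) *
        ∏' k : ℕ,
          Psi (fun n => z ^ (k + 1) * unionA h Xa n) (unionA h Ya) * (1 - z ^ (k + 1))⁻¹ := by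
  refine MvPowerSeries.ext fun m => ?_
  obtain ⟨g, hg, r, hgr, hr⟩ := Cylindric.exists_lift_cylindric h m
  refine (Cylindric.Lift.tsum (fun m' => ?_) hg).cong hr hgr m le_rfl
  obtain ⟨g', hg', r', hgr', hr'⟩ := Cylindric.exists_lift_cylindric h m'
  exact ⟨g', hg', fun k hk => hgr' k hk ▸ hr'.coeff_ne_top hk⟩
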